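/- arXiv:2402.09673 — 2 statements merged into one kernel-verified Lean document; each statement's English description precedes it below -/
import Mathlib

section
/- For every integer n ≥ 1 and every real number x, Σ_{i=1}^{n} ( x^i · ∏_{j=i}^{n−1} (1 − 2^j) ) = Σ_{j=1}^{n} ( binom₂(n−1, j−1) · x · ∏_{i=1}^{j−1} (x − 2^i) ), where empty products equal 1. -/
/-- The Gaussian binomial coefficient `binom₂(a,b)` (base 2), as a real number;
`0` when `b > a`. -/
noncomputable def gbinomR (a b : ℕ) : ℝ :=
  if b ≤ a then
    ∏ ι ∈ Finset.range b, (((2 : ℝ) ^ (a - ι) - 1) / ((2 : ℝ) ^ (b - ι) - 1))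
  else 0

open Finset

theorem gbinomR_zero_right (a : ℕ) : gbinomR a 0 = 1 := by
  simp [gbinomR]

theorem gbinomR_eq_zero_of_lt {a b : ℕ} (h : a < b) : gbinomR a b = 0 := by
  simp [gbinomR, Nat.not_le.mpr h]

theorem two_pow_succ_sub_one_ne_zero (b : ℕ) : (2 : ℝ) ^ (b + 1) - 1 ≠ 0 :=
  (sub_pos.mpr (one_lt_pow₀ one_lt_two b.succ_ne_zero)).ne'

/-- The absorption identity for Gaussian binomial coefficients. -/
theorem gbinomR_succ_succ_mul (a b : ℕ) :
    gbinomR (a + 1) (b + 1) * ((2 : ℝ) ^ (b + 1) - 1) = ((2 : ℝ) ^ (a + 1) - 1) * gbinomR a b := by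
  have hb := two_pow_succ_sub_one_ne_zero b
  by_cases h : b ≤ a
  · simp only [gbinomR, h, Nat.succ_le_succ_iff, if_true, prod_range_succ',
      Nat.add_sub_add_right, Nat.sub_zero]
    field_simp
  · simp [gbinomR, h]

theorem gbinomR_succ_left_mul (a b : ℕ) :
    ((2 : ℝ) ^ (a + 1) - 2 ^ b) * gbinomR (a + 1) b
      = 2 ^ b * ((2 : ℝ) ^ (a + 1) - 1) * gbinomR a b := by
  induction a generalizing b with
  | zero =>
    rcases b with _ | _ | b
    · norm_num [gbinomR_zero_right]
    · simp [gbinomR_eq_zero_of_lt]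
    · simp [gbinomR_eq_zero_of_lt]
  | succ a ih =>
    rcases b with _ | b
    · simp [gbinomR_zero_right]
    · apply mul_right_cancel₀ (two_pow_succ_sub_one_ne_zero b)
      have h₁ := gbinomR_succ_succ_mul (a + 1) b
      have h₂ := gbinomR_succ_succ_mul a b
      linear_combination ((2 : ℝ) ^ (a + 1 + 1) - 2 ^ (b + 1)) * h₁
        + 2 * ((2 : ℝ) ^ (a + 1 + 1) - 1) * ih b
        - 2 ^ (b + 1) * ((2 : ℝ) ^ (a + 1 + 1) - 1) * h₂

/-- The Pascal recurrence for Gaussian binomial coefficients. -/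
theorem gbinomR_succ_succ (a b : ℕ) :
    gbinomR (a + 1) (b + 1) = gbinomR a b + 2 ^ (b + 1) * gbinomR a (b + 1) := by
  apply mul_right_cancel₀ (two_pow_succ_sub_one_ne_zero b)
  rw [gbinomR_succ_succ_mul]
  rcases a with _ | a
  · rcases b with _ | b
    · simp [gbinomR_zero_right, gbinomR_eq_zero_of_lt]
    · simp [gbinomR_eq_zero_of_lt]
  · linear_combination 2 * gbinomR_succ_left_mul a b
      - 2 ^ (b + 1) * gbinomR_succ_succ_mul a b

/-- Cauchy's expansion of `x ^ m` in the basis `∏ i < k, (x - 2 ^ i)`. -/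
theorem sum_gbinomR_mul_prod_range (m : ℕ) (x : ℝ) :
    ∑ k ∈ range (m + 1), gbinomR m k * ∏ i ∈ range k, (x - (2 : ℝ) ^ i) = x ^ m := by
  induction m with
  | zero => simp [gbinomR_zero_right]
  | succ m ih =>
    have hshift : ∑ k ∈ range (m + 1), 2 ^ k * gbinomR m k * ∏ i ∈ range k, (x - (2 : ℝ) ^ i)
        = ∑ k ∈ range (m + 1),
            2 ^ (k + 1) * gbinomR m (k + 1) * ∏ i ∈ range (k + 1), (x - (2 : ℝ) ^ i) + 1 := by
      have h := sum_range_succ' (fun k ↦ 2 ^ k * gbinomR m k * ∏ i ∈ range k, (x - (2 : ℝ) ^ i))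
        (m + 1)
      rw [sum_range_succ, gbinomR_eq_zero_of_lt m.lt_succ_self] at h
      simpa [gbinomR_zero_right] using h
    have hmul : x ^ (m + 1)
        = ∑ k ∈ range (m + 1), gbinomR m k * ∏ i ∈ range (k + 1), (x - (2 : ℝ) ^ i)
          + ∑ k ∈ range (m + 1), 2 ^ k * gbinomR m k * ∏ i ∈ range k, (x - (2 : ℝ) ^ i) := by
      rw [pow_succ, ← ih, sum_mul, ← sum_add_distrib]
      refine sum_congr rfl fun k _ ↦ ?_
      rw [prod_range_succ]
      ring
    rw [hmul, hshift, sum_range_succ', ← add_assoc, ← sum_add_distrib]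
    simp [gbinomR_zero_right, gbinomR_succ_succ, add_mul]

theorem prod_range_succ_sub_two_pow (k : ℕ) (x : ℝ) :
    ∏ i ∈ range (k + 1), (x - (2 : ℝ) ^ i)
      = ∏ i ∈ range (k + 1), (x - (2 : ℝ) ^ (i + 1))
        + (2 ^ (k + 1) - 1) * ∏ i ∈ range k, (x - (2 : ℝ) ^ (i + 1)) := by
  rw [prod_range_succ', prod_range_succ (fun i ↦ x - (2 : ℝ) ^ (i + 1))]
  ring

theorem sum_gbinomR_succ_mul_prod (m : ℕ) (x : ℝ) :
    ∑ k ∈ range (m + 2), gbinomR (m + 1) k * ∏ i ∈ range k, (x - (2 : ℝ) ^ (i + 1))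
      = x ^ (m + 1) + (1 - 2 ^ (m + 1)) *
        ∑ k ∈ range (m + 1), gbinomR m k * ∏ i ∈ range k, (x - (2 : ℝ) ^ (i + 1)) := by
  rw [← sum_gbinomR_mul_prod_range (m + 1), sum_range_succ', sum_range_succ' _ (m + 1), mul_sum,
    add_right_comm, ← sum_add_distrib]
  congr 1
  refine sum_congr rfl fun k _ ↦ ?_
  rw [prod_range_succ_sub_two_pow]
  linear_combination -(∏ i ∈ range k, (x - (2 : ℝ) ^ (i + 1))) * gbinomR_succ_succ_mul m k

theorem sum_Icc_pow_mul_prod_eq (m : ℕ) (x : ℝ) :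
    ∑ i ∈ Icc 1 (m + 1), x ^ i * ∏ j ∈ Icc i m, (1 - (2 : ℝ) ^ j)
      = x * ∑ k ∈ range (m + 1), gbinomR m k * ∏ i ∈ range k, (x - (2 : ℝ) ^ (i + 1)) := by
  induction m with
  | zero => simp [gbinomR_zero_right]
  | succ m ih =>
    have hstep : ∑ i ∈ Icc 1 (m + 1), x ^ i * ∏ j ∈ Icc i (m + 1), (1 - (2 : ℝ) ^ j)
        = (∑ i ∈ Icc 1 (m + 1), x ^ i * ∏ j ∈ Icc i m, (1 - (2 : ℝ) ^ j))
          * (1 - 2 ^ (m + 1)) := by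
      rw [sum_mul]
      refine sum_congr rfl fun i hi ↦ ?_
      rw [prod_Icc_succ_top (mem_Icc.mp hi).2, mul_assoc]
    rw [sum_Icc_succ_top (by lia), hstep, ih, sum_gbinomR_succ_mul_prod,
      Icc_eq_empty (by lia), prod_empty]
    ring

/-- The polynomial identity underlying Lemma 3:
`Σ_{i=1}^{n} x^i ∏_{j=i}^{n−1} (1−2^j) = Σ_{j=1}^{n} binom₂(n−1,j−1) · x · ∏_{i=1}^{j−1} (x−2^i)`. -/
theorem mersenne_poly_identity (n : ℕ) (hn : 1 ≤ n) (x : ℝ) :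
    ∑ i ∈ Finset.Icc 1 n, x ^ i * ∏ j ∈ Finset.Icc i (n - 1), (1 - (2 : ℝ) ^ j)
      = ∑ j ∈ Finset.Icc 1 n,
          gbinomR (n - 1) (j - 1) * x * ∏ i ∈ Finset.Icc 1 (j - 1), (x - (2 : ℝ) ^ i) := by
  obtain ⟨m, rfl⟩ := Nat.exists_eq_add_of_le' hn
  have hprod (k : ℕ) : ∏ i ∈ Icc 1 k, (x - (2 : ℝ) ^ i)
      = ∏ i ∈ range k, (x - (2 : ℝ) ^ (i + 1)) := by
    rw [range_eq_Ico, prod_Ico_add' (fun i ↦ x - (2 : ℝ) ^ i)]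
    rfl
  have hsum (f : ℕ → ℝ) : ∑ j ∈ Icc 1 (m + 1), f (j - 1) = ∑ k ∈ range (m + 1), f k := by
    rw [range_eq_Ico, ← Ico_add_one_right_eq_Icc, ← sum_Ico_add' (fun j ↦ f (j - 1)) 0 (m + 1) 1]
    simp
  rw [Nat.add_sub_cancel, sum_Icc_pow_mul_prod_eq,
    hsum fun k ↦ gbinomR m k * x * ∏ i ∈ Icc 1 k, (x - (2 : ℝ) ^ i), mul_sum]
  refine sum_congr rfl fun k _ ↦ ?_
  rw [hprod]
  ring
end

section
/- Local optimality of the uniform vector fraction code (Theorem 3): the vector q̄ defined by q̄(0) = 0 and q̄(v) = 1/(2^κ − 1) for all v ≠ 0 is a local minimizer of the function q ↦ l(q) relative to the set Δ (i.e., IsLocalMinOn l Δ q̄). -/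
attribute [local instance] Classical.propDecidable

noncomputable instance {κ : ℕ} : Fintype (Submodule (ZMod 2) (Fin κ → ZMod 2)) :=
  haveI : Finite (Submodule (ZMod 2) (Fin κ → ZMod 2)) :=
    Finite.of_injective (fun S => (S : Set (Fin κ → ZMod 2))) SetLike.coe_injective
  Fintype.ofFinite _

/-- `ζ(S,q)`: the sum of `q v` over the vectors `v` lying in the subspace `S`. -/
noncomputable def zeta (κ : ℕ) (S : Submodule (ZMod 2) (Fin κ → ZMod 2))
    (q : (Fin κ → ZMod 2) → ℝ) : ℝ :=
  ∑ v : Fin κ → ZMod 2, if v ∈ S then q v else 0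

/-- The feasible simplex `Δ` of code-definition vectors. -/
def simplex (κ : ℕ) : Set ((Fin κ → ZMod 2) → ℝ) :=
  {q | (∀ v, 0 ≤ q v) ∧ ∑ v, q v = 1}

/-- The expected equivocation loss
`l(q) = n(1−ε) − κ + Σ_{δ=1}^{κ} K_δ Σ_{dim S = κ−δ} ε^{n(1−ζ(S,q))}`,
where `K_δ = ∏_{i=1}^{δ−1} (1 − 2^i)` and the power is the real power. -/
noncomputable def eqLoss (κ n : ℕ) (ε : ℝ) (q : (Fin κ → ZMod 2) → ℝ) : ℝ :=
  (n : ℝ) * (1 - ε) - (κ : ℝ) +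
    ∑ δ ∈ Finset.Icc 1 κ,
      (∏ i ∈ Finset.Icc 1 (δ - 1), (1 - (2 : ℝ) ^ i)) *
        ∑ S ∈ Finset.univ.filter
            (fun S : Submodule (ZMod 2) (Fin κ → ZMod 2) =>
              Module.finrank (ZMod 2) S = κ - δ),
          ε ^ ((n : ℝ) * (1 - zeta κ S q))

/-- The uniform vector fraction code: `q̄(0) = 0`, `q̄(v) = 1/(2^κ − 1)` for `v ≠ 0`. -/
noncomputable def qbar (κ : ℕ) : (Fin κ → ZMod 2) → ℝ :=
  fun v => if v = 0 then 0 else 1 / ((2 : ℝ) ^ κ - 1)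

/-- The coefficient `K_d = ∏_{i=1}^{d-1} (1 - 2^i)`. -/
noncomputable def codimCoeff (d : ℕ) : ℝ := ∏ i ∈ Finset.Icc 1 (d - 1), (1 - (2 : ℝ) ^ i)

theorem codimCoeff_succ {d : ℕ} (hd : 1 ≤ d) :
    codimCoeff (d + 1) = codimCoeff d * (1 - 2 ^ d) := by
  obtain ⟨e, rfl⟩ := Nat.exists_eq_add_of_le' hd
  simp [codimCoeff, Finset.prod_Icc_succ_top]

theorem codimCoeff_one : codimCoeff 1 = 1 := by simp [codimCoeff]

theorem sum_ite_mem_eq_two_pow {κ : ℕ} (S : Submodule (ZMod 2) (Fin κ → ZMod 2)) :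
    ∑ v : Fin κ → ZMod 2, (if v ∈ S then (1 : ℝ) else 0) =
      2 ^ Module.finrank (ZMod 2) S := by
  have h := Module.card_eq_pow_finrank (K := ZMod 2) (V := S)
  rw [ZMod.card] at h
  rw [Finset.sum_boole, ← Fintype.card_subtype]
  exact_mod_cast h

theorem mem_sup_span_singleton_zmod_two {κ : ℕ} {Q : Submodule (ZMod 2) (Fin κ → ZMod 2)}
    {u x : Fin κ → ZMod 2} :
    x ∈ Q ⊔ Submodule.span (ZMod 2) {u} ↔ x ∈ Q ∨ ∃ y ∈ Q, x = u + y := by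
  rw [Submodule.mem_sup]
  constructor
  · rintro ⟨y, hy, z, hz, rfl⟩
    obtain ⟨a, rfl⟩ := Submodule.mem_span_singleton.1 hz
    rcases (by decide : ∀ b : ZMod 2, b = 0 ∨ b = 1) a with rfl | rfl
    · left; simpa using hy
    · right; exact ⟨y, hy, by simp [add_comm]⟩
  · rintro (hx | ⟨y, hy, rfl⟩)
    · exact ⟨x, hx, 0, zero_mem _, add_zero x⟩
    · exact ⟨y, hy, u, Submodule.mem_span_singleton_self u, add_comm _ _⟩

theorem inf_eq_and_mem_iff {κ : ℕ} {R Q S : Submodule (ZMod 2) (Fin κ → ZMod 2)}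
    {u y : Fin κ → ZMod 2} (hRQ : R ≤ Q) (hu : u ∉ Q) (hy : y ∈ Q) :
    (S ⊓ Q = R ∧ u + y ∈ S) ↔
      S ⊓ (Q ⊔ Submodule.span (ZMod 2) {u}) = R ⊔ Submodule.span (ZMod 2) {u + y} := by
  constructor
  · rintro ⟨rfl, hS⟩
    ext x
    simp only [Submodule.mem_inf, mem_sup_span_singleton_zmod_two]
    constructor
    · rintro ⟨hxS, hxQ | ⟨z, hz, rfl⟩⟩
      · exact Or.inl ⟨hxS, hxQ⟩
      · refine Or.inr ⟨z - y, ⟨?_, sub_mem hz hy⟩, by abel⟩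
        have := sub_mem hxS hS
        rwa [add_sub_add_left_eq_sub] at this
    · rintro (⟨hxS, hxQ⟩ | ⟨z, ⟨hzS, hzQ⟩, rfl⟩)
      · exact ⟨hxS, Or.inl hxQ⟩
      · exact ⟨add_mem hS hzS, Or.inr ⟨y + z, add_mem hy hzQ, by abel⟩⟩
  · intro h
    have key : ∀ x, (x ∈ S ∧ (x ∈ Q ∨ ∃ z ∈ Q, x = u + z)) ↔
        (x ∈ R ∨ ∃ z ∈ R, x = u + y + z) := by
      intro x
      have := SetLike.ext_iff.1 h x
      simpa only [Submodule.mem_inf, mem_sup_span_singleton_zmod_two] using this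
    refine ⟨?_, ((key (u + y)).2 (Or.inr ⟨0, zero_mem _, by simp⟩)).1⟩
    ext x
    rw [Submodule.mem_inf]
    constructor
    · rintro ⟨hxS, hxQ⟩
      rcases (key x).1 ⟨hxS, Or.inl hxQ⟩ with hx | ⟨z, hz, rfl⟩
      · exact hx
      · refine absurd ?_ hu
        rw [add_assoc] at hxQ
        exact (add_mem_cancel_right (add_mem hy (hRQ hz))).1 hxQ
    · intro hx
      exact ⟨((key x).2 (Or.inl hx)).1, hRQ hx⟩

theorem sum_ite_mem_and_add_mem {κ : ℕ} {R Q S : Submodule (ZMod 2) (Fin κ → ZMod 2)}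
    {u : Fin κ → ZMod 2} (hu : u ∉ Q) (hS : S ⊓ Q = R) :
    ∑ y : Fin κ → ZMod 2, (if y ∈ Q ∧ u + y ∈ S then (1 : ℝ) else 0) =
      if S ⊓ (Q ⊔ Submodule.span (ZMod 2) {u}) = R then 0 else
        2 ^ Module.finrank (ZMod 2) R := by
  have hRQ : R ≤ Q := hS ▸ inf_le_right
  split_ifs with h
  · refine Finset.sum_eq_zero fun y _ => if_neg ?_
    rintro ⟨hy, hyS⟩
    refine hu ((add_mem_cancel_right hy).1 (hRQ ?_))
    rw [← h]
    exact ⟨hyS, mem_sup_span_singleton_zmod_two.2 (Or.inr ⟨y, hy, rfl⟩)⟩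
  · have hne : ∃ y₀ ∈ Q, u + y₀ ∈ S := by
      by_contra! hno
      refine h (le_antisymm (fun x hx => ?_) ?_)
      · rcases mem_sup_span_singleton_zmod_two.1 hx.2 with hxQ | ⟨y, hy, rfl⟩
        · exact hS ▸ ⟨hx.1, hxQ⟩
        · exact absurd hx.1 (hno y hy)
      · rw [← hS]
        exact inf_le_inf_left _ le_sup_left
    obtain ⟨y₀, hy₀, hy₀S⟩ := hne
    rw [← sum_ite_mem_eq_two_pow,
      ← Equiv.sum_comp (Equiv.subRight y₀) fun z => if z ∈ R then (1 : ℝ) else 0]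
    refine Finset.sum_congr rfl fun y _ => ?_
    congr 1
    rw [Equiv.subRight_apply, ← hS, Submodule.mem_inf, Submodule.sub_mem_iff_left _ hy₀, eq_iff_iff,
      and_comm, show u + y = (y - y₀) + (u + y₀) by abel, add_mem_cancel_right hy₀S]

/-- For `R < Q`, the codimension coefficients of the subspaces meeting `Q` in `R` sum to the
coefficient of `dim Q - dim R`. -/
theorem sum_codimCoeff_inf_eq {κ : ℕ} (R Q : Submodule (ZMod 2) (Fin κ → ZMod 2))
    (hRQ : R < Q) :
    ∑ S : Submodule (ZMod 2) (Fin κ → ZMod 2),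
        (if S ⊓ Q = R then codimCoeff (κ - Module.finrank (ZMod 2) S) else 0) =
      codimCoeff (Module.finrank (ZMod 2) Q - Module.finrank (ZMod 2) R) := by
  induction hm : κ - Module.finrank (ZMod 2) Q generalizing R Q with
  | zero =>
    have hle := Submodule.finrank_le Q
    rw [Module.finrank_fin_fun] at hle
    have hQ : Q = ⊤ := Submodule.eq_top_of_finrank_eq (by rw [Module.finrank_fin_fun]; omega)
    subst hQ
    simp
  | succ m ih =>
    have hQ : Q ≠ ⊤ := by
      rintro rfl
      simp at hm
    obtain ⟨u, -, hu⟩ := SetLike.exists_of_lt (lt_top_iff_ne_top.2 hQ)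
    have hfQ := Submodule.finrank_sup_span_singleton (K := ZMod 2) hu
    set Q' := Q ⊔ Submodule.span (ZMod 2) {u} with hQ'
    have hlt := Submodule.finrank_lt_finrank_of_lt hRQ
    have hfirst := ih R Q' (hRQ.trans_le le_sup_left) (by omega)
    have hsplit : ∀ S : Submodule (ZMod 2) (Fin κ → ZMod 2),
        2 ^ Module.finrank (ZMod 2) R *
          (if S ⊓ Q = R then codimCoeff (κ - Module.finrank (ZMod 2) S) else 0) =
        2 ^ Module.finrank (ZMod 2) R *
          (if S ⊓ Q' = R then codimCoeff (κ - Module.finrank (ZMod 2) S) else 0) +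
        ∑ y : Fin κ → ZMod 2, if y ∈ Q then
          (if S ⊓ Q' = R ⊔ Submodule.span (ZMod 2) {u + y} then
            codimCoeff (κ - Module.finrank (ZMod 2) S) else 0) else 0 := by
      intro S
      have hy : ∀ y : Fin κ → ZMod 2, (if y ∈ Q then
          (if S ⊓ Q' = R ⊔ Submodule.span (ZMod 2) {u + y} then
            codimCoeff (κ - Module.finrank (ZMod 2) S) else 0) else 0) =
          if S ⊓ Q = R then (if y ∈ Q ∧ u + y ∈ S then (1 : ℝ) else 0) *
            codimCoeff (κ - Module.finrank (ZMod 2) S) else 0 := by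
        intro y
        by_cases hyQ : y ∈ Q
        · simp only [hyQ, if_true, true_and, ← inf_eq_and_mem_iff hRQ.le hu hyQ, hQ']
          by_cases h1 : S ⊓ Q = R <;> by_cases h2 : u + y ∈ S <;> simp [h1, h2]
        · simp [hyQ]
      simp only [hy]
      by_cases hS : S ⊓ Q = R
      · simp only [hS, if_true]
        rw [← Finset.sum_mul, sum_ite_mem_and_add_mem hu hS]
        split_ifs <;> simp
      · have : S ⊓ Q' ≠ R := by
          rintro rfl
          refine hS ?_
          refine le_antisymm (inf_le_inf_left _ le_sup_left) (le_inf inf_le_left hRQ.le)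
        simp [hS, this]
    have hsecond : ∀ y ∈ Q, ∑ S : Submodule (ZMod 2) (Fin κ → ZMod 2),
        (if S ⊓ Q' = R ⊔ Submodule.span (ZMod 2) {u + y} then
            codimCoeff (κ - Module.finrank (ZMod 2) S) else 0) =
        codimCoeff (Module.finrank (ZMod 2) Q - Module.finrank (ZMod 2) R) := by
      intro y hy
      have huy : u + y ∉ R := fun h => hu ((add_mem_cancel_right hy).1 (hRQ.le h))
      have hfR := Submodule.finrank_sup_span_singleton (K := ZMod 2) huy
      have hle : R ⊔ Submodule.span (ZMod 2) {u + y} ≤ Q' := by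
        refine sup_le (hRQ.le.trans le_sup_left) ?_
        rw [Submodule.span_singleton_le_iff_mem]
        exact mem_sup_span_singleton_zmod_two.2 (Or.inr ⟨y, hy, rfl⟩)
      rw [ih _ Q' (lt_of_le_of_ne hle fun h => by rw [h] at hfR; omega) (by omega), hfQ, hfR,
        Nat.add_sub_add_right]
    have htotal := Finset.sum_congr (rfl : Finset.univ = Finset.univ) fun S _ => hsplit S
    rw [← Finset.mul_sum, Finset.sum_add_distrib, ← Finset.mul_sum, hfirst, Finset.sum_comm]
      at htotal
    have hswap : ∀ y : Fin κ → ZMod 2, ∑ S : Submodule (ZMod 2) (Fin κ → ZMod 2),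
        (if y ∈ Q then (if S ⊓ Q' = R ⊔ Submodule.span (ZMod 2) {u + y} then
            codimCoeff (κ - Module.finrank (ZMod 2) S) else 0) else 0) =
        (if y ∈ Q then (1 : ℝ) else 0) *
          codimCoeff (Module.finrank (ZMod 2) Q - Module.finrank (ZMod 2) R) := by
      intro y
      by_cases hy : y ∈ Q
      · simp only [hy, if_true, one_mul, hsecond y hy]
      · simp [hy]
    simp only [hswap] at htotal
    rw [← Finset.sum_mul, sum_ite_mem_eq_two_pow, hfQ,
      Nat.sub_add_comm hlt.le, codimCoeff_succ (by omega)] at htotal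
    have hpow : (2 : ℝ) ^ Module.finrank (ZMod 2) Q = 2 ^ Module.finrank (ZMod 2) R *
        2 ^ (Module.finrank (ZMod 2) Q - Module.finrank (ZMod 2) R) := by
      rw [← pow_add, Nat.add_sub_cancel' hlt.le]
    rw [hpow] at htotal
    have h2 : (2 : ℝ) ^ Module.finrank (ZMod 2) R ≠ 0 := by positivity
    apply mul_left_cancel₀ h2
    rw [htotal]
    ring

theorem sum_codimCoeff_le_notMem {κ : ℕ} (T : Submodule (ZMod 2) (Fin κ → ZMod 2))
    (v : Fin κ → ZMod 2) :
    ∑ S : Submodule (ZMod 2) (Fin κ → ZMod 2),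
        (if T ≤ S ∧ v ∉ S then codimCoeff (κ - Module.finrank (ZMod 2) S) else 0) =
      if v ∈ T then 0 else 1 := by
  split_ifs with hv
  · exact Finset.sum_eq_zero fun S _ => if_neg fun h => h.2 (h.1 hv)
  · have hf := Submodule.finrank_sup_span_singleton (K := ZMod 2) hv
    have hlt : T < T ⊔ Submodule.span (ZMod 2) {v} :=
      lt_of_le_of_ne le_sup_left fun h => by rw [← h] at hf; omega
    have := sum_codimCoeff_inf_eq _ _ hlt
    rw [hf, Nat.add_sub_cancel_left, codimCoeff_one] at this
    rw [← this]
    refine Finset.sum_congr rfl fun S _ => ?_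
    congr 1
    rw [eq_iff_iff]
    constructor
    · rintro ⟨hTS, hvS⟩
      refine le_antisymm (fun x hx => ?_) (le_inf hTS le_sup_left)
      rcases mem_sup_span_singleton_zmod_two.1 hx.2 with h | ⟨y, hy, rfl⟩
      · exact h
      · exact absurd ((add_mem_cancel_right (hTS hy)).1 hx.1) hvS
    · intro h
      refine ⟨h ▸ inf_le_left, fun hvS => hv ?_⟩
      rw [← h]
      exact ⟨hvS, Submodule.mem_sup_right (Submodule.mem_span_singleton_self v)⟩

/-- A combination of exponentials whose coefficients have constant first and second order sums
over the non-distinguished points is minimal at the origin, relative to the directions which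
sum to zero and are nonnegative at the distinguished point `o`. -/
theorem exists_pos_forall_sum_mul_exp_sub_one_nonneg {ι V : Type*} [Fintype ι] [Fintype V]
    (a : ι → ℝ) (c G M : ℝ) (hc : 0 < c) (hG : 0 < G) (hM : 0 < M) (mem : V → ι → Prop) (o : V)
    (ho : ∀ S, mem o S)
    (hfst : ∀ v, v ≠ o → ∑ S, (if mem v S then 0 else a S) = G)
    (hsnd : ∀ v w, v ≠ o → w ≠ o → v ≠ w →
      ∑ S, (if mem w S ∧ ¬ mem v S then a S else 0) = M) :
    ∃ r > 0, ∀ t : V → ℝ, ∑ v, t v = 0 → 0 ≤ t o → (∀ v, |t v| ≤ r) →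
      0 ≤ ∑ S, a S * (Real.exp (c * ∑ v, if mem v S then t v else 0) - 1) := by
  set N : ℝ := (Fintype.card V : ℝ) with hN
  set A : ℝ := ∑ S, |a S| with hA
  have hA0 : 0 ≤ A := Finset.sum_nonneg fun _ _ => abs_nonneg _
  have hNpos : 0 < N := by
    have : Nonempty V := ⟨o⟩
    exact Nat.cast_pos.2 Fintype.card_pos
  refine ⟨min (1 / (c * N)) (min (G / (c * M)) (M / (2 * c * N ^ 2 * (A + 1)))),
    by positivity, fun t ht hto htr => ?_⟩
  set r := min (1 / (c * N)) (min (G / (c * M)) (M / (2 * c * N ^ 2 * (A + 1)))) with hr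
  have hr0 : 0 ≤ r := (abs_nonneg _).trans (htr o)
  have hr1 : c * (N * r) ≤ 1 := by
    have := (le_div_iff₀ (by positivity)).1 (min_le_left (1 / (c * N)) _ : r ≤ _)
    linarith
  have hr2 : c * M * r ≤ G := by
    have : r ≤ G / (c * M) := (min_le_right _ _).trans (min_le_left _ _)
    rw [le_div_iff₀ (by positivity)] at this
    linarith
  have hr3 : 2 * c * N ^ 2 * (A + 1) * r ≤ M := by
    have : r ≤ M / (2 * c * N ^ 2 * (A + 1)) := (min_le_right _ _).trans (min_le_right _ _)
    rw [le_div_iff₀ (by positivity)] at this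
    linarith
  set u : ι → ℝ := fun S => ∑ v, if mem v S then t v else 0 with hu
  have hu' : ∀ S, u S = -∑ v, t v * (if mem v S then 0 else 1) := by
    intro S
    refine eq_neg_of_add_eq_zero_left (Eq.trans ?_ ht)
    rw [← Finset.sum_add_distrib]
    refine Finset.sum_congr rfl fun v _ => ?_
    split_ifs <;> simp
  have hpair : ∀ v w, ∑ S, a S * ((if mem v S then 0 else 1) * (if mem w S then 0 else 1)) =
      (G - M) * ((if v = o then 0 else 1) * (if w = o then 0 else 1)) +
        if v = w then M * (if v = o then 0 else 1) else 0 := by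
    intro v w
    by_cases hv : v = o
    · subst hv
      simp [ho]
    by_cases hw : w = o
    · subst hw
      simp [ho, hv]
    by_cases hvw : v = w
    · subst hvw
      simp only [hv, if_false, if_true, ← hfst v hv]
      rw [mul_one, mul_one, mul_one, sub_add_cancel]
      refine Finset.sum_congr rfl fun S _ => ?_
      split_ifs <;> simp
    · simp only [hv, hw, hvw, if_false, ← hsnd v w hv hw hvw, ← hfst v hv]
      rw [mul_one, mul_one, add_zero, ← Finset.sum_sub_distrib]
      refine Finset.sum_congr rfl fun S _ => ?_
      by_cases h1 : mem v S <;> by_cases h2 : mem w S <;> simp [h1, h2]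
  have hsum_ne : ∑ v, t v * (if v = o then (0 : ℝ) else 1) = -t o := by
    have : ∀ v, t v * (if v = o then (0 : ℝ) else 1) = t v - if v = o then t v else 0 := by
      intro v; split_ifs <;> simp
    simp [this, ht]
  have hsq_ne : ∑ v, t v ^ 2 * (if v = o then (0 : ℝ) else 1) = ∑ v, t v ^ 2 - t o ^ 2 := by
    have : ∀ v, t v ^ 2 * (if v = o then (0 : ℝ) else 1) =
        t v ^ 2 - if v = o then t v ^ 2 else 0 := by
      intro v; split_ifs <;> simp
    simp [this]
  have hlin : ∑ S, a S * u S = G * t o := by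
    simp only [hu', mul_neg, Finset.sum_neg_distrib, Finset.mul_sum]
    rw [Finset.sum_comm, neg_eq_iff_eq_neg, ← mul_neg, ← hsum_ne, Finset.mul_sum]
    refine Finset.sum_congr rfl fun v _ => ?_
    have hv : ∑ S, a S * (if mem v S then (0 : ℝ) else 1) = G * (if v = o then 0 else 1) := by
      by_cases hv : v = o
      · subst hv; simp [ho]
      · simp [hv, ← hfst v hv]
    rw [← mul_left_comm, ← hv, Finset.mul_sum]
    exact Finset.sum_congr rfl fun S _ => by ring
  have hquad : ∑ S, a S * u S ^ 2 = (G - M) * t o ^ 2 + M * (∑ v, t v ^ 2 - t o ^ 2) := by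
    have h1 : ∀ S, a S * u S ^ 2 = ∑ v, ∑ w, t v * t w *
        (a S * ((if mem v S then 0 else 1) * (if mem w S then 0 else 1))) := by
      intro S
      rw [hu', neg_sq, sq, Finset.sum_mul_sum, Finset.mul_sum]
      refine Finset.sum_congr rfl fun v _ => ?_
      rw [Finset.mul_sum]
      exact Finset.sum_congr rfl fun w _ => by ring
    simp only [h1]
    rw [Finset.sum_comm]
    have h2 : ∀ v, ∑ S, ∑ w, t v * t w *
        (a S * ((if mem v S then 0 else 1) * (if mem w S then 0 else 1))) =
        (G - M) * (t v * (if v = o then 0 else 1)) * ∑ w, t w * (if w = o then (0 : ℝ) else 1) +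
          M * (t v ^ 2 * (if v = o then 0 else 1)) := by
      intro v
      rw [Finset.sum_comm]
      simp only [← Finset.mul_sum, hpair, mul_add, Finset.sum_add_distrib]
      congr 1
      · rw [Finset.mul_sum]
        exact Finset.sum_congr rfl fun w _ => by ring
      · simp only [mul_ite, mul_zero, Finset.sum_ite_eq, Finset.mem_univ, if_true]
        split_ifs <;> ring
    simp only [h2]
    rw [Finset.sum_add_distrib, ← Finset.sum_mul, ← Finset.mul_sum, ← Finset.mul_sum, hsum_ne,
      hsq_ne]
    ring
  set s : ℝ := ∑ v, |t v| with hs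
  set q : ℝ := ∑ v, t v ^ 2 with hq
  have hs0 : 0 ≤ s := Finset.sum_nonneg fun _ _ => abs_nonneg _
  have hsr : s ≤ N * r := by
    simpa [hN] using Finset.sum_le_card_nsmul Finset.univ (fun v => |t v|) r fun v _ => htr v
  have hsq : s ^ 2 ≤ N * q := by
    simpa [hN, hq] using sq_sum_le_card_mul_sum_sq (s := Finset.univ) (f := fun v => |t v|)
  have hus : ∀ S, |u S| ≤ s := by
    intro S
    refine (Finset.abs_sum_le_sum_abs _ _).trans (Finset.sum_le_sum fun v _ => ?_)
    split_ifs
    · exact le_rfl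
    · simp
  have hrem : ∀ S, a S * (c * u S) + a S * ((c * u S) ^ 2 / 2) - |a S| * (c * s) ^ 3 ≤
      a S * (Real.exp (c * u S) - 1) := by
    intro S
    have habs : |c * u S| ≤ c * s := by
      rw [abs_mul, abs_of_pos hc]
      exact mul_le_mul_of_nonneg_left (hus S) hc.le
    have hle1 : |c * u S| ≤ 1 :=
      habs.trans ((mul_le_mul_of_nonneg_left hsr hc.le).trans hr1)
    have hb := Real.exp_bound hle1 (n := 3) (by norm_num)
    simp only [Finset.sum_range_succ, Finset.sum_range_zero, Nat.factorial] at hb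
    norm_num at hb
    have hcube : |c * u S| ^ 3 ≤ (c * s) ^ 3 := pow_le_pow_left₀ (abs_nonneg _) habs 3
    have hcube0 : 0 ≤ |c * u S| ^ 3 := by positivity
    have hb' : |Real.exp (c * u S) - 1 - c * u S - (c * u S) ^ 2 / 2| ≤ (c * s) ^ 3 := by
      have he : Real.exp (c * u S) - 1 - c * u S - (c * u S) ^ 2 / 2 =
        Real.exp (c * u S) - (1 + c * u S + (c * u S) ^ 2 / 2) := by ring
      rw [he]
      rw [← abs_mul] at hb
      linarith
    have hmul := mul_le_mul_of_nonneg_left hb' (abs_nonneg (a S))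
    rw [← abs_mul] at hmul
    have := neg_abs_le (a S * (Real.exp (c * u S) - 1 - c * u S - (c * u S) ^ 2 / 2))
    nlinarith
  have hsumrem := Finset.sum_le_sum fun S (_ : S ∈ Finset.univ) => hrem S
  refine le_trans ?_ hsumrem
  have heval : ∑ S, (a S * (c * u S) + a S * ((c * u S) ^ 2 / 2) - |a S| * (c * s) ^ 3) =
      c * (G * t o) + c ^ 2 / 2 * ((G - M) * t o ^ 2 + M * (q - t o ^ 2)) -
        A * (c * s) ^ 3 := by
    rw [Finset.sum_sub_distrib, Finset.sum_add_distrib, ← Finset.sum_mul, ← hlin, ← hquad]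
    simp only [Finset.mul_sum]
    refine congrArg₂ _ (congrArg₂ _ ?_ ?_) rfl
    · exact Finset.sum_congr rfl fun S _ => by ring
    · exact Finset.sum_congr rfl fun S _ => by ring
  rw [heval]
  have hq0 : 0 ≤ q := Finset.sum_nonneg fun _ _ => sq_nonneg _
  have htor : t o ≤ r := (le_abs_self _).trans (htr o)
  have hcubic : A * (c * s) ^ 3 ≤ c ^ 2 / 2 * M * q := by
    have h1 : s ^ 3 ≤ N * r * (N * q) := by
      rw [pow_succ, mul_comm]
      exact mul_le_mul hsr hsq (sq_nonneg s) (by positivity)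
    calc A * (c * s) ^ 3 = A * c ^ 3 * s ^ 3 := by ring
      _ ≤ A * c ^ 3 * (N * r * (N * q)) := by gcongr
      _ ≤ (A + 1) * c ^ 3 * (N * r * (N * q)) := by gcongr; linarith
      _ = c ^ 2 / 2 * (2 * c * N ^ 2 * (A + 1) * r) * q := by ring
      _ ≤ c ^ 2 / 2 * M * q := by gcongr
  have hlead : c ^ 2 * M * t o ^ 2 ≤ c * (G * t o) := by
    have : c * M * t o ≤ G :=
      (mul_le_mul_of_nonneg_left htor (by positivity)).trans hr2
    calc c ^ 2 * M * t o ^ 2 = c * ((c * M * t o) * t o) := by ring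
      _ ≤ c * (G * t o) := by gcongr
  have hsq0 : 0 ≤ c ^ 2 / 2 * (G * t o ^ 2) := by positivity
  linarith

/-- The coefficient of the subspace `S` in the expansion of the loss around the uniform vector
fraction code, where `x` is the probability that all positions carrying a given nonzero vector
are erased. -/
noncomputable def lossCoeff {κ : ℕ} (x : ℝ) (S : Submodule (ZMod 2) (Fin κ → ZMod 2)) : ℝ :=
  (if S = ⊤ then 0 else codimCoeff (κ - Module.finrank (ZMod 2) S)) *
    x ^ (2 ^ κ - 2 ^ Module.finrank (ZMod 2) S)

theorem two_pow_finrank_le {κ : ℕ} (S : Submodule (ZMod 2) (Fin κ → ZMod 2)) :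
    2 ^ Module.finrank (ZMod 2) S ≤ 2 ^ κ := by
  have := Submodule.finrank_le S
  rw [Module.finrank_fin_fun] at this
  exact Nat.pow_le_pow_right (by norm_num) this

theorem pow_eq_sum_subset {κ : ℕ} (x : ℝ) (S : Submodule (ZMod 2) (Fin κ → ZMod 2)) :
    x ^ (2 ^ κ - 2 ^ Module.finrank (ZMod 2) S) =
      ∑ A : Finset (Fin κ → ZMod 2),
        if (A : Set (Fin κ → ZMod 2)) ⊆ S then (1 - x) ^ A.card * x ^ (2 ^ κ - A.card) else 0 := by
  set s : Finset (Fin κ → ZMod 2) := Finset.univ.filter (· ∈ S) with hs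
  have hcard : s.card = 2 ^ Module.finrank (ZMod 2) S := by
    have := sum_ite_mem_eq_two_pow S
    rw [Finset.sum_boole] at this
    exact_mod_cast this
  have hle := two_pow_finrank_le S
  rw [← hcard] at hle ⊢
  have hsub : ∀ A : Finset (Fin κ → ZMod 2),
      (A : Set (Fin κ → ZMod 2)) ⊆ S ↔ A ∈ s.powerset := by
    intro A
    rw [Finset.mem_powerset]
    refine forall_congr' fun v => ?_
    simp [hs]
  simp only [hsub]
  rw [Finset.sum_ite_mem, Finset.univ_inter]
  have h1 := Finset.sum_pow_mul_eq_add_pow (1 - x) x s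
  rw [sub_add_cancel, one_pow] at h1
  refine (one_mul (x ^ _)).symm.trans ((congrArg (· * x ^ _) h1).symm.trans ?_)
  rw [Finset.sum_mul]
  refine Finset.sum_congr rfl fun A hA => ?_
  have := Finset.card_le_card (Finset.mem_powerset.1 hA)
  rw [mul_assoc, ← pow_add]
  congr 2
  omega

theorem sum_lossCoeff_mem_notMem_pos {κ : ℕ} {x : ℝ} (hx0 : 0 < x) (hx1 : x < 1)
    {v w : Fin κ → ZMod 2} (hvw : v ∉ Submodule.span (ZMod 2) {w}) :
    0 < ∑ S : Submodule (ZMod 2) (Fin κ → ZMod 2),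
      if w ∈ S ∧ v ∉ S then lossCoeff x S else 0 := by
  have hterm : ∀ S : Submodule (ZMod 2) (Fin κ → ZMod 2),
      (if w ∈ S ∧ v ∉ S then lossCoeff x S else 0) =
      ∑ A : Finset (Fin κ → ZMod 2), (1 - x) ^ A.card * x ^ (2 ^ κ - A.card) *
        if Submodule.span (ZMod 2) (insert w (A : Set (Fin κ → ZMod 2))) ≤ S ∧ v ∉ S then
          codimCoeff (κ - Module.finrank (ZMod 2) S) else 0 := by
    intro S
    simp only [Submodule.span_le, Set.insert_subset_iff, SetLike.mem_coe]
    by_cases hS : w ∈ S ∧ v ∉ S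
    · have htop : S ≠ ⊤ := by
        rintro rfl
        exact hS.2 Submodule.mem_top
      simp only [hS, lossCoeff, htop, if_true, if_false, pow_eq_sum_subset, Finset.mul_sum,
        true_and, and_true, not_false_eq_true]
      refine Finset.sum_congr rfl fun A _ => ?_
      split_ifs <;> ring
    · rw [if_neg hS]
      refine (Finset.sum_eq_zero fun A _ => ?_).symm
      rw [if_neg fun h => hS ⟨h.1.1, h.2⟩, mul_zero]
  simp only [hterm]
  rw [Finset.sum_comm]
  simp only [← Finset.mul_sum, sum_codimCoeff_le_notMem]
  have hy : 0 < 1 - x := sub_pos.2 hx1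
  refine Finset.sum_pos' (fun A _ => ?_) ⟨∅, Finset.mem_univ _, ?_⟩
  · split_ifs <;> positivity
  · simp only [Finset.coe_empty, insert_empty_eq, if_neg hvw]
    positivity

theorem sum_lossCoeff_mem_notMem_map {κ : ℕ} (x : ℝ)
    (g : (Fin κ → ZMod 2) ≃ₗ[ZMod 2] (Fin κ → ZMod 2)) (v w : Fin κ → ZMod 2) :
    ∑ S : Submodule (ZMod 2) (Fin κ → ZMod 2),
        (if g w ∈ S ∧ g v ∉ S then lossCoeff x S else 0) =
      ∑ S : Submodule (ZMod 2) (Fin κ → ZMod 2),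
        if w ∈ S ∧ v ∉ S then lossCoeff x S else 0 := by
  rw [← Equiv.sum_comp (Submodule.orderIsoMapComap g).toEquiv]
  refine Finset.sum_congr rfl fun S _ => ?_
  have hmem : ∀ z, g z ∈ S.map (g : (Fin κ → ZMod 2) →ₗ[ZMod 2] (Fin κ → ZMod 2)) ↔ z ∈ S := by
    intro z
    simp
  have hf : Module.finrank (ZMod 2)
      (S.map (g : (Fin κ → ZMod 2) →ₗ[ZMod 2] (Fin κ → ZMod 2))) =
        Module.finrank (ZMod 2) S := LinearEquiv.finrank_map_eq g S
  have hcoeff : lossCoeff x (S.map (g : (Fin κ → ZMod 2) →ₗ[ZMod 2] (Fin κ → ZMod 2))) =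
      lossCoeff x S := by
    have htop : S.map (g : (Fin κ → ZMod 2) →ₗ[ZMod 2] (Fin κ → ZMod 2)) = ⊤ ↔ S = ⊤ :=
      map_eq_top_iff (f := Submodule.orderIsoMapComap g)
    simp only [lossCoeff, hf, htop]
  change (if g w ∈ S.map (g : (Fin κ → ZMod 2) →ₗ[ZMod 2] (Fin κ → ZMod 2)) ∧
    g v ∉ S.map (g : (Fin κ → ZMod 2) →ₗ[ZMod 2] (Fin κ → ZMod 2)) then
      lossCoeff x (S.map (g : (Fin κ → ZMod 2) →ₗ[ZMod 2] (Fin κ → ZMod 2))) else 0) = _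
  simp only [hmem, hcoeff]

theorem LinearIndependent.exists_linearEquiv_apply_eq {K V ι : Type*} [Field K] [AddCommGroup V]
    [Module K V] [Finite ι] {f g : ι → V} (hf : LinearIndependent K f)
    (hg : LinearIndependent K g) : ∃ e : V ≃ₗ[K] V, ∀ i, e (f i) = g i := by
  have := FiniteDimensional.span_of_finite K (Set.finite_range f)
  obtain ⟨e, he⟩ := Submodule.exists_linearEquiv_restrict_eq
    (hf.linearCombinationEquiv.symm.trans hg.linearCombinationEquiv)
  refine ⟨e, fun i => ?_⟩
  have h1 : hf.linearCombinationEquiv (Finsupp.single i 1) =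
      ⟨f i, Submodule.subset_span (Set.mem_range_self i)⟩ := by
    ext
    simp
  have h2 := he (hf.linearCombinationEquiv (Finsupp.single i 1))
  rw [LinearEquiv.trans_apply, LinearEquiv.symm_apply_apply, h1] at h2
  rw [← h2]
  simp

theorem linearIndependent_pair_zmod_two {V : Type*} [AddCommGroup V] [Module (ZMod 2) V]
    {v w : V} (hv : v ≠ 0) (hw : w ≠ 0) (hvw : v ≠ w) :
    LinearIndependent (ZMod 2) ![v, w] := by
  rw [LinearIndependent.pair_iff]
  intro a b hab
  have hcases : ∀ c : ZMod 2, c = 0 ∨ c = 1 := by decide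
  have hneg : -w = w := by
    rw [neg_eq_iff_add_eq_zero, ← two_smul (ZMod 2) w, show (2 : ZMod 2) = 0 from rfl, zero_smul]
  rcases hcases a with rfl | rfl <;> rcases hcases b with rfl | rfl
  · exact ⟨rfl, rfl⟩
  · simp [hw] at hab
  · simp [hv] at hab
  · rw [one_smul, one_smul, add_eq_zero_iff_eq_neg, hneg] at hab
    exact absurd hab hvw

theorem exists_sum_lossCoeff_notMem_eq {κ : ℕ} {x : ℝ} (hx0 : 0 < x) (hx1 : x < 1) :
    ∃ G > 0, ∀ v : Fin κ → ZMod 2, v ≠ 0 →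
      ∑ S : Submodule (ZMod 2) (Fin κ → ZMod 2), (if v ∈ S then 0 else lossCoeff x S) = G := by
  by_cases h : ∃ v₀ : Fin κ → ZMod 2, v₀ ≠ 0
  · obtain ⟨v₀, hv₀⟩ := h
    refine ⟨_, sum_lossCoeff_mem_notMem_pos hx0 hx1 (v := v₀) (w := 0) (by simpa using hv₀),
      fun v hv => ?_⟩
    obtain ⟨g, hg⟩ := LinearIndependent.exists_linearEquiv_apply_eq
      (linearIndependent_unique_iff.2 hv₀ : LinearIndependent (ZMod 2) fun _ : Unit => v₀)
      (linearIndependent_unique_iff.2 hv : LinearIndependent (ZMod 2) fun _ : Unit => v)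
    rw [← sum_lossCoeff_mem_notMem_map x g v₀, hg (), map_zero]
    refine Finset.sum_congr rfl fun S _ => ?_
    by_cases hS : v ∈ S <;> simp [hS]
  · push Not at h
    exact ⟨1, one_pos, fun v hv => absurd (h v) hv⟩

theorem exists_sum_lossCoeff_mem_notMem_eq {κ : ℕ} {x : ℝ} (hx0 : 0 < x) (hx1 : x < 1) :
    ∃ M > 0, ∀ v w : Fin κ → ZMod 2, v ≠ 0 → w ≠ 0 → v ≠ w →
      ∑ S : Submodule (ZMod 2) (Fin κ → ZMod 2),
        (if w ∈ S ∧ ¬ v ∈ S then lossCoeff x S else 0) = M := by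
  by_cases h : ∃ v₀ w₀ : Fin κ → ZMod 2, v₀ ≠ 0 ∧ w₀ ≠ 0 ∧ v₀ ≠ w₀
  · obtain ⟨v₀, w₀, hv₀, hw₀, hne₀⟩ := h
    have hspan : v₀ ∉ Submodule.span (ZMod 2) {w₀} := by
      rw [Submodule.mem_span_singleton]
      rintro ⟨a, rfl⟩
      rcases (by decide : ∀ b : ZMod 2, b = 0 ∨ b = 1) a with rfl | rfl
      · simp at hv₀
      · simp at hne₀
    refine ⟨_, sum_lossCoeff_mem_notMem_pos hx0 hx1 hspan, fun v w hv hw hne => ?_⟩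
    obtain ⟨g, hg⟩ := LinearIndependent.exists_linearEquiv_apply_eq
      (linearIndependent_pair_zmod_two hv₀ hw₀ hne₀) (linearIndependent_pair_zmod_two hv hw hne)
    have hgv : g v₀ = v := hg 0
    have hgw : g w₀ = w := hg 1
    rw [← sum_lossCoeff_mem_notMem_map x g v₀ w₀, hgv, hgw]
  · push Not at h
    exact ⟨1, one_pos, fun v w hv hw hne => absurd (h v w hv hw) hne⟩

theorem eqLoss_eq_sum_submodule (κ n : ℕ) (ε : ℝ) (q : (Fin κ → ZMod 2) → ℝ) :
    eqLoss κ n ε q = (n : ℝ) * (1 - ε) - (κ : ℝ) +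
      ∑ S : Submodule (ZMod 2) (Fin κ → ZMod 2),
        (if S = ⊤ then 0 else codimCoeff (κ - Module.finrank (ZMod 2) S)) *
          ε ^ ((n : ℝ) * (1 - zeta κ S q)) := by
  rw [eqLoss]
  congr 1
  simp only [Finset.sum_filter, Finset.mul_sum]
  rw [Finset.sum_comm]
  refine Finset.sum_congr rfl fun S _ => ?_
  have hle := Submodule.finrank_le S
  rw [Module.finrank_fin_fun] at hle
  by_cases hS : S = ⊤
  · rw [if_pos hS, zero_mul]
    refine Finset.sum_eq_zero fun δ hδ => ?_
    rw [Finset.mem_Icc] at hδ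
    rw [if_neg, mul_zero]
    rw [hS, finrank_top, Module.finrank_fin_fun]
    omega
  · have hlt := Submodule.finrank_lt (lt_top_iff_ne_top.2 hS).ne
    rw [Module.finrank_fin_fun] at hlt
    rw [if_neg hS, Finset.sum_eq_single (κ - Module.finrank (ZMod 2) S)]
    · rw [if_pos (by omega), codimCoeff]
    · intro δ hδ hne
      rw [Finset.mem_Icc] at hδ
      rw [if_neg (by omega), mul_zero]
    · intro hnot
      rw [Finset.mem_Icc] at hnot
      omega

theorem zeta_qbar {κ : ℕ} (S : Submodule (ZMod 2) (Fin κ → ZMod 2)) :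
    zeta κ S (qbar κ) = (2 ^ Module.finrank (ZMod 2) S - 1) / (2 ^ κ - 1) := by
  have hterm : ∀ v : Fin κ → ZMod 2, (if v ∈ S then qbar κ v else 0) =
      ((if v ∈ S then (1 : ℝ) else 0) - if v = 0 then 1 else 0) * (1 / ((2 : ℝ) ^ κ - 1)) := by
    intro v
    by_cases hv : v = 0
    · subst hv
      simp [qbar]
    · by_cases hS : v ∈ S <;> simp [qbar, hv, hS]
  simp only [zeta, hterm]
  rw [← Finset.sum_mul, Finset.sum_sub_distrib, sum_ite_mem_eq_two_pow, Finset.sum_ite_eq',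
    if_pos (Finset.mem_univ _), mul_one_div]

theorem rpow_one_sub_zeta {κ : ℕ} (n : ℕ) (hκ : 1 ≤ κ) {ε : ℝ} (hε0 : 0 < ε)
    (S : Submodule (ZMod 2) (Fin κ → ZMod 2)) (q : (Fin κ → ZMod 2) → ℝ) :
    ε ^ ((n : ℝ) * (1 - zeta κ S q)) =
      (ε ^ ((n : ℝ) / (2 ^ κ - 1))) ^ (2 ^ κ - 2 ^ Module.finrank (ZMod 2) S) *
        Real.exp (-(n * Real.log ε) * ∑ v, if v ∈ S then q v - qbar κ v else 0) := by
  have hz : ∑ v, (if v ∈ S then q v - qbar κ v else 0) = zeta κ S q - zeta κ S (qbar κ) := by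
    rw [zeta, zeta, ← Finset.sum_sub_distrib]
    refine Finset.sum_congr rfl fun v _ => ?_
    split_ifs <;> simp
  have hden : (2 : ℝ) ^ κ - 1 ≠ 0 := by
    have : (1 : ℝ) < 2 ^ κ := one_lt_pow₀ (by norm_num) (by omega)
    linarith
  rw [hz, zeta_qbar, ← Real.rpow_mul_natCast hε0.le, Real.rpow_def_of_pos hε0,
    Real.rpow_def_of_pos hε0, ← Real.exp_add, Nat.cast_sub (two_pow_finrank_le S)]
  congr 1
  push_cast
  field_simp
  ring

theorem sum_qbar {κ : ℕ} (hκ : 1 ≤ κ) : ∑ v, qbar κ v = 1 := by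
  have hden : (2 : ℝ) ^ κ - 1 ≠ 0 := by
    have : (1 : ℝ) < 2 ^ κ := one_lt_pow₀ (by norm_num) (by omega)
    linarith
  have h := zeta_qbar (κ := κ) ⊤
  rw [finrank_top, Module.finrank_fin_fun, div_self hden] at h
  simpa [zeta] using h

/-- Theorem 3: the uniform vector fraction code is a local minimizer of the
expected equivocation loss on the simplex. -/
theorem uniform_vector_fraction_local_opt (κ n : ℕ) (hκ : 1 ≤ κ) (hn : 1 ≤ n)
    (ε : ℝ) (hε0 : 0 < ε) (hε1 : ε < 1) :
    IsLocalMinOn (eqLoss κ n ε) (simplex κ) (qbar κ) := by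
  have hn0 : (0 : ℝ) < n := by exact_mod_cast hn
  have hden : (0 : ℝ) < 2 ^ κ - 1 := sub_pos.2 (one_lt_pow₀ (by norm_num) (by omega))
  set x : ℝ := ε ^ ((n : ℝ) / (2 ^ κ - 1)) with hx
  have hx0 : 0 < x := Real.rpow_pos_of_pos hε0 _
  have hx1 : x < 1 := Real.rpow_lt_one hε0.le hε1 (by positivity)
  have hc : 0 < -(n * Real.log ε) := by
    have := mul_pos hn0 (neg_pos.2 (Real.log_neg hε0 hε1))
    linarith
  obtain ⟨G, hG, hfst⟩ := exists_sum_lossCoeff_notMem_eq (κ := κ) hx0 hx1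
  obtain ⟨M, hM, hsnd⟩ := exists_sum_lossCoeff_mem_notMem_eq (κ := κ) hx0 hx1
  obtain ⟨r, hr, hmin⟩ := exists_pos_forall_sum_mul_exp_sub_one_nonneg
    (lossCoeff (κ := κ) x) _ G M hc hG hM (fun v S => v ∈ S) 0 (fun S => zero_mem S) hfst hsnd
  have hloss : ∀ q, eqLoss κ n ε q = (n : ℝ) * (1 - ε) - (κ : ℝ) +
      ∑ S : Submodule (ZMod 2) (Fin κ → ZMod 2), lossCoeff x S *
        Real.exp (-(n * Real.log ε) * ∑ v, if v ∈ S then q v - qbar κ v else 0) := by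
    intro q
    simp only [eqLoss_eq_sum_submodule, rpow_one_sub_zeta n hκ hε0, lossCoeff, mul_assoc, ← hx]
  filter_upwards [self_mem_nhdsWithin,
    mem_nhdsWithin_of_mem_nhds (Metric.ball_mem_nhds (qbar κ) hr)] with q hq hqr
  have hpos := hmin (fun v => q v - qbar κ v)
    (by rw [Finset.sum_sub_distrib, hq.2, sum_qbar hκ, sub_self])
    (by simpa [qbar] using hq.1 0)
    (fun v => (norm_le_pi_norm (q - qbar κ) v).trans (mem_ball_iff_norm.1 hqr).le)
  simp only [mul_sub, mul_one, Finset.sum_sub_distrib] at hpos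
  rw [hloss q, hloss (qbar κ)]
  simp only [sub_self, ite_self, Finset.sum_const_zero, mul_zero, Real.exp_zero, mul_one]
  linarith
end
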